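/- Let t and t' be rooted trees with |t| ≤ |t'|. Then n(t;t')·|SG(t')| = |SG(t)|·m(t;t'), where n(t;t') and m(t;t') are the generalized multiplicities defined via iterates of the growth and pruning operators. -/

import Mathlib

attribute [local instance] Classical.propDecidable

inductive PlanarTree : Type where
  | node : List PlanarTree → PlanarTree

namespace PlanarTree

/-- Isomorphism of (planar representatives of) rooted trees: the lists of
principal branches match up, pairwise isomorphically, after a permutation. -/
inductive Iso : PlanarTree → PlanarTree → Prop where
  | node {l m l' : List PlanarTree} :
      List.Perm l m → List.Forall₂ Iso m l' → Iso (node l) (node l')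

/-- Number of vertices. -/
def size : PlanarTree → ℕ
  | node l => 1 + (l.attach.map fun c => size c.1).sum
decreasing_by simp only [PlanarTree.node.sizeOf_spec]; exact Nat.lt_of_lt_of_le (List.sizeOf_lt_of_mem c.2) (Nat.le_add_left _ _)

mutual
  /-- All trees obtained by attaching the root of `s` by a new edge to some vertex. -/
  def graftList (s : PlanarTree) : PlanarTree → List PlanarTree
    | node l => node (s :: l) :: (graftAux s l).map node
  def graftAux (s : PlanarTree) : List PlanarTree → List (List PlanarTree)
    | [] => []
    | a :: l => ((graftList s a).map (· :: l)) ++ (graftAux s l).map (a :: ·)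
end

/-- All trees obtained by adding a new edge and terminal vertex at some vertex. -/
def growList (t : PlanarTree) : List PlanarTree := graftList (node []) t

mutual
  /-- All trees obtained by deleting one (non-root) terminal vertex. -/
  def pruneList : PlanarTree → List PlanarTree
    | node l => (pruneAux l).map node
  def pruneAux : List PlanarTree → List (List PlanarTree)
    | [] => []
    | a :: l =>
        (match a with | node [] => [l] | _ => []) ++
        ((pruneList a).map (· :: l)) ++ (pruneAux l).map (a :: ·)
end

mutual
  /-- All pairs (cut-off subtree, remaining tree) obtained by cutting one edge. -/
  def cutPairs : PlanarTree → List (PlanarTree × PlanarTree)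
    | node l => (cutAux l).map fun x => (x.1, node x.2)
  def cutAux : List PlanarTree → List (PlanarTree × List PlanarTree)
    | [] => []
    | a :: l =>
        (a, l) :: (((cutPairs a).map fun x => (x.1, x.2 :: l)) ++
          (cutAux l).map fun x => (x.1, a :: x.2))
end

/-- The order of the symmetry group `SG(t)`: the product over all vertices `v`
of the number of permutations of the branches at `v` exchanging isomorphic branches. -/
noncomputable def sg : PlanarTree → ℕ
  | node l =>
      (l.attach.map fun c => sg c.1).prod *
        Nat.card {σ : Equiv.Perm (Fin l.length) // ∀ i, Iso (l.get (σ i)) (l.get i)}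
decreasing_by simp only [PlanarTree.node.sizeOf_spec]; exact Nat.lt_of_lt_of_le (List.sizeOf_lt_of_mem c.2) (Nat.le_add_left _ _)

/-- Vertices of a planar tree, encoded as paths of child-indices from the root. -/
inductive IsVertex : PlanarTree → List ℕ → Prop where
  | root (t : PlanarTree) : IsVertex t []
  | child {l : List PlanarTree} {i : ℕ} {c : PlanarTree} {p : List ℕ} :
      l[i]? = some c → IsVertex c p → IsVertex (node l) (i :: p)

def Vertex (t : PlanarTree) : Type := {p : List ℕ // IsVertex t p}

/-- `v` lies strictly below `w` in the tree order (i.e. `w` is a proper ancestor of `v`). -/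
def StrictBelow {t : PlanarTree} (v w : Vertex t) : Prop := w.1 <+: v.1 ∧ w.1 ≠ v.1

/-- A labelling of `t`. -/
def Labelling (t : PlanarTree) : Type :=
  {f : Vertex t ≃ Fin t.size // ∀ v w, StrictBelow v w → f w < f v}

/-- Equivalence of labellings: they differ by an automorphism of the rooted tree. -/
def labelEquiv {t : PlanarTree} (f g : Labelling t) : Prop :=
  ∃ φ : Equiv.Perm (Vertex t),
    (∀ v w, StrictBelow (φ v) (φ w) ↔ StrictBelow v w) ∧ ∀ v, f.1 (φ v) = g.1 v

end PlanarTree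

/-- Rooted trees: isomorphism classes of planar rooted trees. -/
instance planarSetoid : Setoid PlanarTree := Relation.EqvGen.setoid PlanarTree.Iso

def RTree : Type := Quotient planarSetoid

namespace RTree

def mk (p : PlanarTree) : RTree := ⟦p⟧

/-- A chosen planar representative. -/
noncomputable def rep (T : RTree) : PlanarTree := Quotient.out T

noncomputable def size (T : RTree) : ℕ := T.rep.size

/-- The order of the symmetry (automorphism) group of `T`. -/
noncomputable def sg (T : RTree) : ℕ := T.rep.sg

/-- The one-vertex tree. -/
def bullet : RTree := mk (PlanarTree.node [])

/-- `Covers T T'` means `T ⊲ T'`: `T` is obtained from `T'` by deleting one terminal vertex. -/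
noncomputable def Covers (T T' : RTree) : Prop :=
  ∃ p ∈ T'.rep.pruneList, mk p = T

/-- `n(T;T')`: the number of vertices of `T` to which a new edge can be added to obtain `T'`. -/
noncomputable def nCov (T T' : RTree) : ℕ :=
  T.rep.growList.countP fun p => decide (mk p = T')

/-- `m(T;T')`: the number of (terminal) edges of `T'` which when removed leave `T`. -/
noncomputable def mCov (T T' : RTree) : ℕ :=
  T'.rep.pruneList.countP fun p => decide (mk p = T)

/-- `n(T₁,T₂;T₃)`: the number of vertices of `T₂` such that attaching the root of `T₁`
there by a new edge yields `T₃`. -/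
noncomputable def nTri (T₁ T₂ T₃ : RTree) : ℕ :=
  (PlanarTree.graftList T₁.rep T₂.rep).countP fun p => decide (mk p = T₃)

/-- `m(T₁,T₂;T₃)`: the number of edges of `T₃` whose removal cuts off a subtree
isomorphic to `T₁` leaving `T₂` (the piece containing the root). -/
noncomputable def mTri (T₁ T₂ T₃ : RTree) : ℕ :=
  T₃.rep.cutPairs.countP fun x => decide (mk x.1 = T₁ ∧ mk x.2 = T₂)

end RTree

section Ops

variable (k : Type*) [Semiring k]

/-- The element `𝔑(T) = Σ_{T ⊲ T'} n(T;T')·T'` of `k{T}`. -/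
noncomputable def growF (T : RTree) : RTree →₀ k :=
  (T.rep.growList.map fun p => Finsupp.single (RTree.mk p) (1 : k)).sum

/-- The element `𝔓(T) = Σ_{T' ⊲ T} m(T';T)·T'` of `k{T}`. -/
noncomputable def pruneF (T : RTree) : RTree →₀ k :=
  (T.rep.pruneList.map fun p => Finsupp.single (RTree.mk p) (1 : k)).sum

/-- The growth operator `𝔑` on `k{T}`. -/
noncomputable def Grow : Module.End k (RTree →₀ k) :=
  Finsupp.linearCombination k (growF k)

/-- The pruning operator `𝔓` on `k{T}`. -/
noncomputable def Prune : Module.End k (RTree →₀ k) :=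
  Finsupp.linearCombination k (pruneF k)

/-- The operator `𝔇` on `k{T}`, `𝔇(t) = |t|·t`. -/
noncomputable def Diag : Module.End k (RTree →₀ k) :=
  Finsupp.linearCombination k fun T => (T.size : k) • Finsupp.single T 1

/-- The inner product on `k{T}` determined by `(t,t') = |SG(t)|·δ_{t,t'}`. -/
noncomputable def innerT (x y : RTree →₀ k) : k :=
  x.sum fun T c => c * y T * (T.sg : k)

/-- Generalized multiplicity `n(T;T')`: coefficient of `T'` in `𝔑^{|T'|-|T|}(T)`. -/
noncomputable def nGen (T T' : RTree) : k :=
  ((Grow k ^ (T'.size - T.size)) (Finsupp.single T 1)) T'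

/-- Generalized multiplicity `m(T;T')`: coefficient of `T` in `𝔓^{|T'|-|T|}(T')`. -/
noncomputable def mGen (T T' : RTree) : k :=
  ((Prune k ^ (T'.size - T.size)) (Finsupp.single T' 1)) T

end Ops

section Kreimer

variable (k : Type*) [CommSemiring k]

/-- Kreimer's Hopf algebra `H_K`, as a commutative algebra: the free polynomial
algebra on rooted trees. -/
abbrev HK := MvPolynomial RTree k

/-- The inclusion `k{T} → H_K` of the linear span of the variables. -/
noncomputable def toHK : (RTree →₀ k) →ₗ[k] HK k :=
  Finsupp.linearCombination k fun T => MvPolynomial.X T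

/-- The growth derivation `N` on `H_K`, with `N(t) = 𝔑(t)` for rooted trees `t`. -/
noncomputable def ND : Derivation k (HK k) (HK k) :=
  MvPolynomial.mkDerivation k fun T => toHK k (growF k T)

/-- The pruning derivation `P` on `H_K`, with `P(t) = 𝔓(t)` for `|t| ≥ 2`, `P(•) = 1`. -/
noncomputable def PD : Derivation k (HK k) (HK k) :=
  MvPolynomial.mkDerivation k fun T =>
    if T = RTree.bullet then 1 else toHK k (pruneF k T)

/-- The grading derivation `D` on `H_K`, multiplying each homogeneous element of
degree `n` by `n`; it is the derivation with `D(t) = |t|·t` for rooted trees `t`. -/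
noncomputable def DD : Derivation k (HK k) (HK k) :=
  MvPolynomial.mkDerivation k fun T => (T.size : k) • MvPolynomial.X T

/-- The map `B₊ : H_K → k{T}` sending a forest to the tree obtained by attaching
all its roots to a new root vertex. -/
noncomputable def forestTree (d : RTree →₀ ℕ) : RTree :=
  RTree.mk (PlanarTree.node
    (d.support.toList.flatMap fun T => List.replicate (d T) T.rep))

noncomputable def Bplus (p : HK k) : RTree →₀ k :=
  ∑ d ∈ p.support, Finsupp.single (forestTree d) (MvPolynomial.coeff d p)

/-- The inner product on `H_K`. -/
noncomputable def innerHK (u v : HK k) : k := innerT k (Bplus k u) (Bplus k v)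

/-- The degree-`n` homogeneous component of `H_K`. -/
noncomputable abbrev HKcomp (n : ℕ) : Submodule k (HK k) :=
  MvPolynomial.weightedHomogeneousSubmodule k (fun T : RTree => T.size) n

/-- `T_i`: the number of rooted trees with `i+1` vertices. -/
noncomputable def Tcard (i : ℕ) : ℕ := Nat.card {T : RTree // T.size = i + 1}

end Kreimer

namespace PlanarTree

theorem induction_on_branches {P : PlanarTree → Prop}
    (h : ∀ l : List PlanarTree, (∀ a ∈ l, P a) → P (node l)) : ∀ t, P t
  | node l => h l fun a _ => induction_on_branches h a
termination_by t => sizeOf t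
decreasing_by
  simp only [PlanarTree.node.sizeOf_spec]
  exact Nat.lt_of_lt_of_le (List.sizeOf_lt_of_mem ‹_›) (Nat.le_add_left _ _)

theorem iso_node_iff {l l' : List PlanarTree} :
    Iso (node l) (node l') ↔ ∃ m, l.Perm m ∧ List.Forall₂ Iso m l' :=
  ⟨fun h => by cases h with | node h₁ h₂ => exact ⟨_, h₁, h₂⟩, fun ⟨_, h₁, h₂⟩ => .node h₁ h₂⟩

theorem Iso.refl (t : PlanarTree) : Iso t t := by
  induction t using induction_on_branches with
  | h l ih => exact .node (List.Perm.refl l) (List.forall₂_same.2 ih)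

theorem Iso.symm {p q : PlanarTree} (h : Iso p q) : Iso q p := by
  induction p using induction_on_branches generalizing q with
  | h l ih =>
    obtain ⟨l'⟩ := q
    obtain ⟨m, hlm, hm⟩ := iso_node_iff.1 h
    have hm' : List.Forall₂ Iso l' m := by
      have ih' : ∀ a ∈ m, ∀ q, Iso a q → Iso q a := fun a ha q => ih a (hlm.mem_iff.2 ha)
      clear hlm h ih
      induction hm with
      | nil => exact .nil
      | cons h _ ihm =>
        exact .cons (ih' _ List.mem_cons_self _ h)
          (ihm fun a ha => ih' a (List.mem_cons_of_mem _ ha))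
    have : Relation.Comp (List.Forall₂ Iso) List.Perm l' l := ⟨m, hm', hlm.symm⟩
    rw [List.forall₂_comp_perm_eq_perm_comp_forall₂] at this
    exact iso_node_iff.2 this

theorem Iso.trans {p q r : PlanarTree} (h : Iso p q) (h' : Iso q r) : Iso p r := by
  induction p using induction_on_branches generalizing q r with
  | h l ih =>
    obtain ⟨l'⟩ := q
    obtain ⟨l''⟩ := r
    obtain ⟨m, hlm, hm⟩ := iso_node_iff.1 h
    obtain ⟨m', hlm', hm'⟩ := iso_node_iff.1 h'
    have : Relation.Comp (List.Forall₂ Iso) List.Perm m m' := ⟨l', hm, hlm'⟩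
    rw [List.forall₂_comp_perm_eq_perm_comp_forall₂] at this
    obtain ⟨n, hmn, hn⟩ := this
    refine iso_node_iff.2 ⟨n, hlm.trans hmn, ?_⟩
    have ih' : ∀ a ∈ n, ∀ q r, Iso a q → Iso q r → Iso a r := fun a ha q r =>
      ih a ((hlm.trans hmn).mem_iff.2 ha)
    clear hlm h h' ih hlm' hmn hm
    induction hn generalizing l'' with
    | nil => cases hm'; exact .nil
    | cons h _ ihn =>
      cases hm' with
      | cons h' hm' =>
        exact .cons (ih' _ List.mem_cons_self _ _ h h')
          (ihn _ hm' fun a ha => ih' a (List.mem_cons_of_mem _ ha))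

theorem mk_eq_mk_iff {p q : PlanarTree} : RTree.mk p = RTree.mk q ↔ Iso p q := by
  have : Equivalence Iso := ⟨Iso.refl, Iso.symm, Iso.trans⟩
  rw [← this.eqvGen_iff]
  exact Quotient.eq (r := planarSetoid)

/-- The multiset of isomorphism classes of the trees in a list. -/
def classes (l : List PlanarTree) : Multiset RTree := (l.map RTree.mk : List RTree)

@[simp] theorem classes_cons (a : PlanarTree) (l : List PlanarTree) :
    classes (a :: l) = RTree.mk a ::ₘ classes l := rfl

theorem mem_classes {a : PlanarTree} {l : List PlanarTree} (h : a ∈ l) :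
    RTree.mk a ∈ classes l :=
  Multiset.mem_coe.2 (List.mem_map_of_mem h)

theorem mk_node_eq_mk_node_iff {l l' : List PlanarTree} :
    RTree.mk (node l) = RTree.mk (node l') ↔ classes l = classes l' := by
  have key : ∀ m, List.Forall₂ Iso m l' ↔ m.map RTree.mk = l'.map RTree.mk := fun m => by
    rw [← List.forall₂_eq_eq_eq, List.forall₂_map_left_iff, List.forall₂_map_right_iff]
    simp only [mk_eq_mk_iff]
  rw [mk_eq_mk_iff, iso_node_iff, classes, classes, Multiset.coe_eq_coe]
  constructor
  · rintro ⟨m, hlm, hm⟩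
    rw [← (key m).1 hm]
    exact hlm.map _
  · intro h
    have : Relation.Comp (List.Forall₂ fun (a : PlanarTree) T => RTree.mk a = T) List.Perm
        l (l'.map RTree.mk) :=
      ⟨l.map RTree.mk, by simp [List.forall₂_map_right_iff, List.forall₂_same], h⟩
    rw [List.forall₂_comp_perm_eq_perm_comp_forall₂] at this
    obtain ⟨m, hlm, hm⟩ := this
    refine ⟨m, hlm, ?_⟩
    simpa only [List.forall₂_map_right_iff, mk_eq_mk_iff] using hm

/-- The number of permutations of a multiset exchanging equal elements. -/
noncomputable def permCount (M : Multiset RTree) : ℕ :=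
  ∏ T ∈ M.toFinset, (M.count T).factorial

theorem permCount_cons (T : RTree) (M : Multiset RTree) :
    permCount (T ::ₘ M) = (T ::ₘ M).count T * permCount M := by
  have h : permCount M = ∏ S ∈ insert T M.toFinset, (M.count S).factorial := by
    refine Finset.prod_subset (Finset.subset_insert _ _) fun S _ hS => ?_
    rw [Multiset.mem_toFinset] at hS
    rw [Multiset.count_eq_zero_of_notMem hS, Nat.factorial_zero]
  rw [h, permCount, Multiset.toFinset_cons,
    ← Finset.mul_prod_erase _ _ (Finset.mem_insert_self T M.toFinset),
    ← Finset.mul_prod_erase _ _ (Finset.mem_insert_self T M.toFinset),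
    Multiset.count_cons_self, Nat.factorial_succ, mul_assoc]
  congr 2
  refine Finset.prod_congr rfl fun S hS => ?_
  rw [Multiset.count_cons_of_ne (Finset.ne_of_mem_erase hS)]

theorem sg_node (l : List PlanarTree) :
    sg (node l) = (l.map sg).prod * permCount (classes l) := by
  rw [sg, List.attach_map_val]
  congr 1
  have h := DomMulAct.stabilizer_card' (fun i : Fin l.length => RTree.mk (l.get i))
  have e : Nat.card {σ : Equiv.Perm (Fin l.length) // ∀ i, Iso (l.get (σ i)) (l.get i)} =
      Fintype.card {g : Equiv.Perm (Fin l.length) //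
        (fun i : Fin l.length => RTree.mk (l.get i)) ∘ g = fun i => RTree.mk (l.get i)} := by
    rw [← Nat.card_eq_fintype_card]
    refine Nat.card_congr (Equiv.subtypeEquivRight fun σ => ?_)
    simp only [funext_iff, Function.comp_apply, mk_eq_mk_iff]
  have hc : classes l = Finset.univ.val.map fun i : Fin l.length => RTree.mk (l.get i) := by
    conv_lhs => rw [← List.map_get_finRange l]
    rw [classes, List.map_map]
    rfl
  rw [e, h, permCount, hc]
  refine Finset.prod_congr ?_ fun T _ => ?_
  · rfl
  · rw [Multiset.count_map, Fintype.card_subtype]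
    simp only [eq_comm]
    rfl

theorem Iso.sg_eq {p q : PlanarTree} (h : Iso p q) : sg p = sg q := by
  induction p using induction_on_branches generalizing q with
  | h l ih =>
    obtain ⟨l'⟩ := q
    rw [sg_node, sg_node, mk_node_eq_mk_node_iff.1 (mk_eq_mk_iff.2 h)]
    congr 1
    obtain ⟨m, hlm, hm⟩ := iso_node_iff.1 h
    rw [(hlm.map sg).prod_eq]
    have ih' : ∀ a ∈ m, ∀ q, Iso a q → sg a = sg q := fun a ha q => ih a (hlm.mem_iff.2 ha)
    clear hlm h ih
    induction hm with
    | nil => rfl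
    | cons h _ ihm =>
      rw [List.map_cons, List.map_cons, List.prod_cons, List.prod_cons,
        ih' _ List.mem_cons_self _ h, ihm fun a ha => ih' a (List.mem_cons_of_mem _ ha)]

@[simp] theorem sg_mk (p : PlanarTree) : (RTree.mk p).sg = sg p :=
  (mk_eq_mk_iff.1 (Quotient.out_eq (s := planarSetoid) (RTree.mk p))).sg_eq

/-- The order of the symmetry group of a tree, in terms of the multiset of its branches. -/
noncomputable def branchSg (M : Multiset RTree) : ℕ := (M.map RTree.sg).prod * permCount M

theorem sg_node_eq_branchSg (l : List PlanarTree) : sg (node l) = branchSg (classes l) := by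
  simp [sg_node, branchSg, classes, Function.comp_def]

theorem branchSg_cons (T : RTree) (M : Multiset RTree) :
    branchSg (T ::ₘ M) = (T ::ₘ M).count T * (T.sg * branchSg M) := by
  rw [branchSg, branchSg, permCount_cons, Multiset.map_cons, Multiset.prod_cons]
  ring

theorem sum_map_count_mul (S M : Multiset RTree) (h : RTree → ℕ) :
    (S.map fun x => M.count x * h x).sum = (M.map fun b => S.count b * h b).sum := by
  have single : ∀ (b : RTree) (S : Multiset RTree),
      (S.map fun x => (if x = b then 1 else 0) * h x).sum = S.count b * h b := fun b S => by
    induction S using Multiset.induction_on with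
    | empty => simp
    | cons x S ih =>
      rw [Multiset.map_cons, Multiset.sum_cons, ih, Multiset.count_cons]
      by_cases hx : x = b
      · subst hx; simp; ring
      · simp [hx, Ne.symm hx]
  induction M using Multiset.induction_on with
  | empty => simp
  | cons b M ih =>
    simp only [Multiset.count_cons, add_mul, Multiset.sum_map_add, ih, single, Multiset.map_cons,
      Multiset.sum_cons]
    ring

/-- Summing over the trees whose addition to `N` yields `M`, weighted by `branchSg M`. -/
theorem sum_map_ite_mul_branchSg (S N M : Multiset RTree) :
    (S.map fun x => if x ::ₘ N = M then 1 else 0).sum * branchSg M =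
      (M.map fun b => S.count b * if b ::ₘ N = M then b.sg * branchSg N else 0).sum := by
  rw [← sum_map_count_mul, ← Multiset.sum_map_mul_right]
  refine congrArg _ (Multiset.map_congr rfl fun x _ => ?_)
  split_ifs with h
  · rw [← h, branchSg_cons, one_mul]
  · simp

theorem erase_classes_cons (a : PlanarTree) {b : PlanarTree} {l : List PlanarTree} (hb : b ∈ l) :
    (classes (a :: l)).erase (RTree.mk b) = RTree.mk a ::ₘ (classes l).erase (RTree.mk b) :=
  Multiset.erase_cons_tail_of_mem (mem_classes hb)

theorem sum_graftAux (s : PlanarTree) (l : List PlanarTree) (g : Multiset RTree → ℕ) :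
    ((graftAux s l).map fun x => g (classes x)).sum =
      (l.map fun a => ((classes (graftList s a)).map
        fun x => g (x ::ₘ (classes l).erase (RTree.mk a))).sum).sum := by
  induction l generalizing g with
  | nil => simp [graftAux]
  | cons a l ih =>
    have h := ih fun M => g (RTree.mk a ::ₘ M)
    rw [graftAux, List.map_append, List.sum_append, List.map_cons, List.sum_cons]
    congr 1
    · simp [classes, Function.comp_def]
    · simp only [List.map_map, Function.comp_def, classes_cons] at h ⊢
      rw [h]
      refine congrArg _ (List.map_congr_left fun b hb => ?_)
      rw [← classes_cons, erase_classes_cons a hb]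
      simp only [Multiset.cons_swap]

theorem pruneAux_cons (a : PlanarTree) (l : List PlanarTree) :
    pruneAux (a :: l) = (if a = node [] then [l] else []) ++
      (pruneList a).map (· :: l) ++ (pruneAux l).map (a :: ·) := by
  obtain ⟨_ | ⟨c, m⟩⟩ := a <;> simp [pruneAux]

theorem sum_pruneAux (l : List PlanarTree) (g : Multiset RTree → ℕ) :
    ((pruneAux l).map fun x => g (classes x)).sum =
      (l.map fun a => (if a = node [] then g ((classes l).erase (RTree.mk a)) else 0) +
        ((classes (pruneList a)).map
          fun x => g (x ::ₘ (classes l).erase (RTree.mk a))).sum).sum := by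
  induction l generalizing g with
  | nil => simp [pruneAux]
  | cons a l ih =>
    have h := ih fun M => g (RTree.mk a ::ₘ M)
    rw [pruneAux_cons, List.map_append, List.sum_append, List.map_append, List.sum_append,
      List.map_cons, List.sum_cons]
    congr 1
    · congr 1
      · split_ifs <;> simp
      · simp [classes, Function.comp_def]
    · simp only [List.map_map, Function.comp_def, classes_cons] at h ⊢
      rw [h]
      refine congrArg _ (List.map_congr_left fun b hb => ?_)
      rw [← classes_cons, erase_classes_cons a hb]
      simp only [Multiset.cons_swap]

theorem count_classes (T : RTree) (l : List PlanarTree) :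
    (classes l).count T = (l.map fun x => if RTree.mk x = T then 1 else 0).sum := by
  induction l with
  | nil => simp [classes]
  | cons a l ih =>
    rw [classes_cons, Multiset.count_cons, ih, List.map_cons, List.sum_cons, add_comm]
    simp only [eq_comm]

theorem count_growList (l l' : List PlanarTree) :
    (classes (growList (node l))).count (RTree.mk (node l')) =
      (if RTree.bullet ::ₘ classes l = classes l' then 1 else 0) +
      (l.map fun a => ((classes (growList a)).map fun x =>
        if x ::ₘ (classes l).erase (RTree.mk a) = classes l' then 1 else 0).sum).sum := by
  have h := sum_graftAux (node []) l fun M => if M = classes l' then 1 else 0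
  rw [growList, graftList, count_classes, List.map_cons, List.sum_cons, List.map_map]
  simp only [Function.comp_def, mk_node_eq_mk_node_iff]
  rw [h]
  rfl

theorem count_pruneList (l l' : List PlanarTree) :
    (classes (pruneList (node l'))).count (RTree.mk (node l)) =
      (l'.map fun b => if b = node [] then
        (if (classes l').erase (RTree.mk b) = classes l then 1 else 0) else 0).sum +
      (l'.map fun b => ((classes (pruneList b)).map fun x =>
        if x ::ₘ (classes l').erase (RTree.mk b) = classes l then 1 else 0).sum).sum := by
  have h := sum_pruneAux l' fun M => if M = classes l then 1 else 0
  rw [pruneList, count_classes, List.map_map]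
  simp only [Function.comp_def, mk_node_eq_mk_node_iff]
  rw [h, List.sum_map_add]

theorem mk_eq_bullet_iff {p : PlanarTree} : RTree.mk p = RTree.bullet ↔ p = node [] := by
  refine ⟨fun h => ?_, fun h => h ▸ rfl⟩
  obtain ⟨l⟩ := p
  have h' := mk_node_eq_mk_node_iff.1 h
  simpa [classes] using h'

theorem sg_bullet : RTree.bullet.sg = 1 := by
  rw [RTree.bullet, sg_mk, sg_node]
  simp [permCount, classes]

theorem bullet_ite_mul_branchSg (M : Multiset RTree) (l' : List PlanarTree) :
    (if RTree.bullet ::ₘ M = classes l' then 1 else 0) * branchSg (classes l') =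
      branchSg M * (l'.map fun b => if b = node [] then
        (if (classes l').erase (RTree.mk b) = M then 1 else 0) else 0).sum := by
  have h : (l'.map fun b => if b = node [] then
        (if (classes l').erase (RTree.mk b) = M then 1 else 0) else 0).sum =
      (classes l').count RTree.bullet *
        if (classes l').erase RTree.bullet = M then 1 else 0 := by
    rw [count_classes, ← List.sum_map_mul_right]
    refine congrArg _ (List.map_congr_left fun b _ => ?_)
    by_cases hb : b = node []
    · rw [if_pos hb, mk_eq_bullet_iff.2 hb, if_pos rfl, one_mul]
    · rw [if_neg hb, if_neg (mt mk_eq_bullet_iff.1 hb), zero_mul]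
  rw [h]
  by_cases hM : RTree.bullet ::ₘ M = classes l'
  · rw [← hM, branchSg_cons, sg_bullet, Multiset.erase_cons_head, if_pos rfl, if_pos rfl]
    ring
  · rw [if_neg hM]
    by_cases hmem : RTree.bullet ∈ classes l'
    · rw [if_neg fun he => hM (by rw [← he, Multiset.cons_erase hmem])]
      simp
    · simp [Multiset.count_eq_zero_of_notMem hmem]

theorem sum_map_classes (l : List PlanarTree) (f : RTree → ℕ) :
    ((classes l).map f).sum = (l.map fun a => f (RTree.mk a)).sum := by
  simp [classes, Function.comp_def]

theorem sum_map_ite_mul_branchSg_classes (S : Multiset RTree) (N : Multiset RTree) (l' : List PlanarTree) :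
    (S.map fun x => if x ::ₘ N = classes l' then 1 else 0).sum * branchSg (classes l') =
      (l'.map fun b => S.count (RTree.mk b) *
        if RTree.mk b ::ₘ N = classes l' then sg b * branchSg N else 0).sum := by
  rw [sum_map_ite_mul_branchSg, sum_map_classes]
  simp only [sg_mk]

theorem count_growList_mul_sg (p q : PlanarTree) :
    (classes (growList p)).count (RTree.mk q) * sg q =
      sg p * (classes (pruneList q)).count (RTree.mk p) := by
  induction p using induction_on_branches generalizing q with
  | h l ih =>
    obtain ⟨l'⟩ := q
    rw [count_growList, count_pruneList, sg_node_eq_branchSg, sg_node_eq_branchSg, add_mul,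
      mul_add, bullet_ite_mul_branchSg]
    congr 1
    rw [mul_comm, ← List.sum_map_mul_left, ← List.sum_map_mul_left]
    simp only [mul_comm (branchSg _), sum_map_ite_mul_branchSg_classes]
    simp only [← Multiset.sum_coe, ← Multiset.map_coe]
    rw [Multiset.sum_map_sum_map]
    refine congrArg _ (Multiset.map_congr rfl fun b hb => congrArg _
      (Multiset.map_congr rfl fun a ha => ?_))
    have hM : RTree.mk b ::ₘ (classes l).erase (RTree.mk a) = classes l' ↔
        RTree.mk a ::ₘ (classes l').erase (RTree.mk b) = classes l := by
      constructor
      · intro h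
        rw [← h, Multiset.erase_cons_head, Multiset.cons_erase (mem_classes ha)]
      · intro h
        rw [← h, Multiset.erase_cons_head, Multiset.cons_erase (mem_classes hb)]
    by_cases h : RTree.mk b ::ₘ (classes l).erase (RTree.mk a) = classes l'
    · rw [if_pos h, if_pos (hM.1 h), ← mul_assoc, ih a ha, ← h, Multiset.erase_cons_head]
      ring
    · rw [if_neg h, if_neg (mt hM.2 h), mul_zero, mul_zero]

end PlanarTree

section Adjoint

open PlanarTree

variable (k : Type*) [Field k]

theorem sum_map_single_apply (l : List PlanarTree) (T : RTree) :
    (l.map fun p => Finsupp.single (RTree.mk p) (1 : k)).sum T = (classes l).count T := by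
  induction l with
  | nil => simp [classes]
  | cons a l ih =>
    rw [List.map_cons, List.sum_cons, Finsupp.add_apply, ih, classes_cons, Multiset.count_cons,
      Finsupp.single_apply]
    push_cast
    simp only [eq_comm, add_comm]

theorem growF_apply_mul_sg (T T' : RTree) :
    growF k T T' * (T'.sg : k) = (T.sg : k) * pruneF k T' T := by
  have h := count_growList_mul_sg T.rep T'.rep
  have hr : ∀ S : RTree, RTree.mk S.rep = S := fun S => Quotient.out_eq _
  rw [hr, hr] at h
  rw [growF, pruneF, sum_map_single_apply, sum_map_single_apply, RTree.sg, RTree.sg]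
  exact_mod_cast congrArg (Nat.cast (R := k)) h

/-- The symmetric bilinear form with `(T, T') = |SG(T)| δ_{T,T'}`. -/
noncomputable def sgForm : (RTree →₀ k) →ₗ[k] (RTree →₀ k) →ₗ[k] k :=
  Finsupp.linearCombination k fun T => (T.sg : k) • Finsupp.lapply T

theorem sgForm_single_left (T : RTree) (y : RTree →₀ k) :
    sgForm k (Finsupp.single T 1) y = (T.sg : k) * y T := by
  simp [sgForm]

theorem sgForm_single_right (x : RTree →₀ k) (T : RTree) :
    sgForm k x (Finsupp.single T 1) = x T * (T.sg : k) := by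
  induction x using Finsupp.induction_linear with
  | zero => simp
  | add f g hf hg => rw [map_add, LinearMap.add_apply, hf, hg, Finsupp.add_apply, add_mul]
  | single S c =>
    by_cases h : S = T
    · subst h; simp [sgForm]
    · simp [sgForm, h]

theorem sgForm_grow (x y : RTree →₀ k) : sgForm k (Grow k x) y = sgForm k x (Prune k y) := by
  have h : (sgForm k).comp (Grow k) = (sgForm k).compl₂ (Prune k) := by
    ext T T'
    simp [Grow, Prune, sgForm_single_left, sgForm_single_right, growF_apply_mul_sg]
  exact LinearMap.congr_fun (LinearMap.congr_fun h x) y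

theorem sgForm_grow_pow (j : ℕ) (x y : RTree →₀ k) :
    sgForm k ((Grow k ^ j) x) y = sgForm k x ((Prune k ^ j) y) := by
  induction j generalizing x with
  | zero => rfl
  | succ j ih => rw [pow_succ, Module.End.mul_apply, ih, sgForm_grow, pow_succ',
      Module.End.mul_apply]

end Adjoint

/-- For `|t| ≤ |t'|`, `n(t;t')·|SG(t')| = |SG(t)|·m(t;t')`
(generalized multiplicities). -/
theorem stmt5 (k : Type*) [Field k] [CharZero k] (t t' : RTree) (h : t.size ≤ t'.size) :
    nGen k t t' * (t'.sg : k) = (t.sg : k) * mGen k t t' := by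
  rw [nGen, mGen, ← sgForm_single_right, sgForm_grow_pow, sgForm_single_left]
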